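/- arXiv:1906.10639 — 7 statements merged into one kernel-verified Lean document; each statement's English description precedes it below -/
import Mathlib

section
/- For all integers M ≥ N ≥ 0 and every real number c, the quantities q_{N,M}(j,c) for j = 0,1,…,N sum to 1; that is, Σ_{j=0}^{N} (D+2j+1)·N!·M!/((N−j)!·(M+j+1)!) · Σ_{m=0}^{D+j} C(D+j,m)·C(j+m,m)·c^m·(1−c)^{M−m} = 1, where D = M − N. (In particular, for c ∈ [0,1], q_{N,M}(·,c) is a probability distribution.) -/
open Finset

/-- The outcome distribution `q_{N,M}(j,c)` of the optimal (weak Schur sampling)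
measurement for estimating the squared overlap `c`, given `N` and `M ≥ N` copies.
Here `D = M - N` and the outcome `j ∈ {0,…,N}` corresponds to `J = (M-N)/2 + j`. -/
noncomputable def overlapDist (N M j : ℕ) (c : ℝ) : ℝ :=
  (((M - N + 2 * j + 1) * Nat.factorial N * Nat.factorial M : ℕ) : ℝ) /
      ((Nat.factorial (N - j) * Nat.factorial (M + j + 1) : ℕ) : ℝ) *
    ∑ m ∈ Finset.range (M - N + j + 1),
      ((Nat.choose (M - N + j) m * Nat.choose (j + m) m : ℕ) : ℝ) * c ^ m * (1 - c) ^ (M - m)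

/-- The common coefficient `C(D+j,m) C(j+m,m)` of the Bernstein monomials. -/
noncomputable def overlapCoeff (D m j : ℕ) : ℝ :=
  (Nat.choose (D + j) m : ℝ) * (Nat.choose (j + m) m : ℝ)

/-- The `j`-th weighted coefficient of the `m`-th Bernstein monomial, without the factor
`N! M!`, where `M = N + D`. -/
noncomputable def overlapTerm (D m N j : ℕ) : ℝ :=
  (D + 2 * j + 1) * overlapCoeff D m j /
    ((Nat.factorial (N - j) : ℝ) * (Nat.factorial (N + D + j + 1) : ℝ))

lemma overlapCoeff_succ (D m j : ℕ) :
    overlapCoeff D m (j + 1) * ((j + 1) * (D + j + 1 - m)) =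
      overlapCoeff D m j * ((D + j + 1) * (j + m + 1)) := by
  have h₁ : (Nat.choose (D + j + 1) m : ℝ) * (D + j + 1 - m) =
      Nat.choose (D + j) m * (D + j + 1) := by
    rcases le_or_gt m (D + j + 1) with h | h
    · have := Nat.choose_mul_succ_eq (D + j) m
      have h' : ((D + j + 1 - m : ℕ) : ℝ) = D + j + 1 - m := by push_cast [Nat.cast_sub h]; ring
      rw [← h']
      exact_mod_cast this.symm
    · rw [Nat.choose_eq_zero_of_lt h, Nat.choose_eq_zero_of_lt (by omega : D + j < m)]
      simp
  have h₂ : (Nat.choose (j + 1 + m) m : ℝ) * (j + 1) = Nat.choose (j + m) m * (j + m + 1) := by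
    have := Nat.choose_mul_succ_eq (j + m) m
    rw [show j + m + 1 - m = j + 1 by omega, show j + m + 1 = j + 1 + m by omega] at this
    have h : ((Nat.choose (j + m) m * (j + 1 + m) : ℕ) : ℝ) =
      ((Nat.choose (j + 1 + m) m * (j + 1) : ℕ) : ℝ) := by rw [this]
    push_cast at h
    linarith
  unfold overlapCoeff
  rw [← add_assoc D j 1]
  linear_combination (Nat.choose (j + 1 + m) m : ℝ) * (j + 1) * h₁ +
    (Nat.choose (D + j) m : ℝ) * (D + j + 1) * h₂

lemma sum_overlapTerm_telescope (D m N k : ℕ) (hk : k ≤ N + 1) :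
    ∑ j ∈ range k, (((N : ℝ) + 1) * (N + D + 1 - m) * overlapTerm D m (N + 1) j -
        overlapTerm D m N j) =
      -(overlapCoeff D m k * (k * (D + k - m)) /
        ((Nat.factorial (N + 1 - k) : ℝ) * (Nat.factorial (N + 1 + D + k) : ℝ))) := by
  induction k with
  | zero => simp
  | succ k ih =>
    rw [sum_range_succ, ih (by omega)]
    obtain ⟨r, rfl⟩ := Nat.exists_eq_add_of_le (by omega : k ≤ N)
    have hc := overlapCoeff_succ D m k
    unfold overlapTerm
    rw [show k + r + 1 - k = r + 1 by omega, show k + r - k = r by omega,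
      show k + r + 1 - (k + 1) = r by omega,
      show k + r + 1 + D + (k + 1) = k + r + D + k + 1 + 1 by omega,
      show k + r + 1 + D + k + 1 = k + r + D + k + 1 + 1 by omega,
      show k + r + 1 + D + k = k + r + D + k + 1 by omega]
    rw [Nat.factorial_succ (k + r + D + k + 1), Nat.factorial_succ r]
    have hf := Nat.cast_ne_zero (R := ℝ).mpr (Nat.factorial_ne_zero (k + r + D + k + 1))
    have hg := Nat.cast_ne_zero (R := ℝ).mpr (Nat.factorial_ne_zero r)
    generalize ((k + r + D + k + 1).factorial) = F at *
    generalize r.factorial = G at *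
    have e : overlapCoeff D m (k + 1) * (((k + 1 : ℕ) : ℝ) * (D + ((k + 1 : ℕ) : ℝ) - m)) =
      overlapCoeff D m k * ((D + k + 1) * (k + m + 1)) := by
      rw [← hc]; push_cast; ring
    rw [e]
    push_cast
    have h₁ : (k : ℝ) + r + D + k + 1 + 1 ≠ 0 := by positivity
    have h₂ : (r : ℝ) + 1 ≠ 0 := by positivity
    field_simp
    ring

lemma sum_overlapTerm_succ (D m N : ℕ) :
    ((N : ℝ) + 1) * (N + D + 1 - m) * ∑ j ∈ range (N + 2), overlapTerm D m (N + 1) j =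
      ∑ j ∈ range (N + 1), overlapTerm D m N j := by
  have h := sum_overlapTerm_telescope D m N (N + 1) le_rfl
  rw [sum_sub_distrib, ← mul_sum] at h
  rw [sum_range_succ, mul_add]
  have hlast : ((N : ℝ) + 1) * (N + D + 1 - m) * overlapTerm D m (N + 1) (N + 1) =
      overlapCoeff D m (N + 1) * (((N + 1 : ℕ) : ℝ) * (D + ((N + 1 : ℕ) : ℝ) - m)) /
        ((Nat.factorial (N + 1 - (N + 1)) : ℝ) * (Nat.factorial (N + 1 + D + (N + 1)) : ℝ)) := by
    unfold overlapTerm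
    rw [Nat.factorial_succ (N + 1 + D + (N + 1)), Nat.sub_self]
    have hf := Nat.cast_ne_zero (R := ℝ).mpr (Nat.factorial_ne_zero (N + 1 + D + (N + 1)))
    generalize (N + 1 + D + (N + 1)).factorial = F at *
    have h₁ : (N : ℝ) + 1 + D + (N + 1) + 1 ≠ 0 := by positivity
    push_cast
    field_simp
    ring
  linarith

lemma sum_overlapTerm (D m N : ℕ) (hm : m ≤ N + D) :
    ∑ j ∈ range (N + 1), overlapTerm D m N j =
      1 / ((Nat.factorial N : ℝ) * (Nat.factorial m * Nat.factorial (N + D - m))) := by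
  induction N with
  | zero =>
    simp only [zero_add] at hm
    have hd := Nat.cast_ne_zero (R := ℝ).mpr (Nat.factorial_ne_zero D)
    have h₁ : (D : ℝ) + 1 ≠ 0 := by positivity
    simp [overlapTerm, overlapCoeff, Nat.cast_choose ℝ hm, Nat.factorial_succ]
    field_simp
  | succ N ih =>
    rcases Nat.lt_or_ge (N + D) m with h | h
    · obtain rfl : m = N + 1 + D := by omega
      rw [sum_range_succ, sum_eq_zero]
      · have hc := Nat.cast_choose ℝ (Nat.le_add_left (N + 1 + D) (N + 1))
        rw [Nat.add_sub_cancel] at hc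
        unfold overlapTerm overlapCoeff
        rw [hc, add_comm D (N + 1), Nat.choose_self, Nat.sub_self, Nat.sub_self,
          Nat.factorial_succ (N + 1 + D + (N + 1)), add_comm (N + 1) (N + 1 + D)]
        have hf := Nat.cast_ne_zero (R := ℝ).mpr (Nat.factorial_ne_zero (N + 1 + D + (N + 1)))
        generalize (N + 1 + D + (N + 1)).factorial = F at *
        have h₁ : (N : ℝ) + 1 + D + (N + 1) + 1 ≠ 0 := by positivity
        simp only [Nat.factorial_zero]
        push_cast
        field_simp
        ring
      · intro j hj
        have : D + j < N + 1 + D := by have := mem_range.mp hj; omega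
        simp [overlapTerm, overlapCoeff, Nat.choose_eq_zero_of_lt this]
    · have hs := sum_overlapTerm_succ D m N
      rw [ih h] at hs
      obtain ⟨r, hr⟩ := Nat.exists_eq_add_of_le h
      have hr' : (N : ℝ) + D = m + r := by exact_mod_cast hr
      rw [show N + 1 + D - m = r + 1 by omega, Nat.factorial_succ r, Nat.factorial_succ N]
      rw [show N + D - m = r by omega, hr', show (m : ℝ) + r + 1 - m = r + 1 by ring] at hs
      have h₁ : (N : ℝ) + 1 ≠ 0 := by positivity
      have h₂ : (r : ℝ) + 1 ≠ 0 := by positivity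
      have h₃ : ((N : ℝ) + 1) * (r + 1) ≠ 0 := mul_ne_zero h₁ h₂
      apply mul_left_cancel₀ h₃
      rw [hs]
      push_cast
      field_simp

lemma overlapDist_eq_sum_overlapTerm (N D j : ℕ) (hj : j ≤ N) (c : ℝ) :
    overlapDist N (N + D) j c =
      ∑ m ∈ range (N + D + 1), (Nat.factorial N * Nat.factorial (N + D) : ℝ) *
        overlapTerm D m N j * (c ^ m * (1 - c) ^ (N + D - m)) := by
  unfold overlapDist
  rw [Nat.add_sub_cancel_left, mul_sum]
  have hsub : range (D + j + 1) ⊆ range (N + D + 1) := range_subset_range.mpr (by omega)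
  rw [← sum_subset hsub]
  · refine sum_congr rfl fun m _ => ?_
    unfold overlapTerm overlapCoeff
    push_cast
    ring
  · intro m _ hm
    have : D + j < m := by simp at hm; omega
    simp [overlapTerm, overlapCoeff, Nat.choose_eq_zero_of_lt this]

/-- For all integers `M ≥ N ≥ 0` and every real `c`, the quantities `q_{N,M}(j,c)`
for `j = 0,…,N` sum to `1`. -/
theorem overlapDist_sum_eq_one (N M : ℕ) (hNM : N ≤ M) (c : ℝ) :
    ∑ j ∈ Finset.range (N + 1), overlapDist N M j c = 1 := by
  obtain ⟨D, rfl⟩ := Nat.exists_eq_add_of_le hNM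
  rw [sum_congr rfl fun j hj =>
    overlapDist_eq_sum_overlapTerm N D j (Nat.lt_succ_iff.mp (mem_range.mp hj)) c, sum_comm]
  have hbinom : ∑ m ∈ range (N + D + 1), c ^ m * (1 - c) ^ (N + D - m) *
      (Nat.choose (N + D) m : ℝ) = 1 := by
    rw [← add_pow]; simp
  refine Eq.trans ?_ hbinom
  refine sum_congr rfl fun m hm => ?_
  have hm' : m ≤ N + D := Nat.lt_succ_iff.mp (mem_range.mp hm)
  rw [← sum_mul, ← mul_sum, sum_overlapTerm D m N hm', Nat.cast_choose ℝ hm']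
  field_simp
end

section
/- For all integers M ≥ N ≥ 0, all j ∈ {0,1,…,N} and every real number c, the following two closed forms of the measurement statistics agree: (D+2j+1)·N!·M!/((N−j)!·(M+j+1)!) · Σ_{m=0}^{D+j} C(D+j,m)·C(j+m,m)·c^m·(1−c)^{M−m} = [(D+2j+1)/(M+N+1)] · [C(M+N+1, N−j)/C(M+N, N)] · (1−c)^{N−j} · Σ_{s=0}^{j} C(D+j,s)·C(j,s)·c^s, where D = M − N. -/
open Finset

/-- The `s`-th factorial moment of the binomial distribution, in homogeneous form. -/
theorem sum_range_choose_mul_choose_mul_pow {R : Type*} [CommSemiring R] (x y : R) (n s : ℕ) :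
    ∑ m ∈ Finset.range (n + 1), ((n.choose m * m.choose s : ℕ) : R) * x ^ m * y ^ (n - m) =
      (n.choose s : R) * x ^ s * (x + y) ^ (n - s) := by
  rcases lt_or_ge n s with h | h
  · rw [Nat.choose_eq_zero_of_lt h]
    simp only [Nat.cast_zero, zero_mul]
    refine Finset.sum_eq_zero fun m hm => ?_
    rw [Nat.choose_eq_zero_of_lt (n := m) (by have := Finset.mem_range.mp hm; omega)]
    simp
  · obtain ⟨t, rfl⟩ := Nat.exists_eq_add_of_le h
    rw [add_assoc, Finset.sum_range_add, Finset.sum_eq_zero, zero_add, Nat.add_sub_cancel_left,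
      add_pow, Finset.mul_sum]
    · refine Finset.sum_congr rfl fun i hi => ?_
      have hi' : i ≤ t := Nat.lt_succ_iff.mp (Finset.mem_range.mp hi)
      rw [Nat.choose_mul (Nat.le_add_right s i),
        Nat.add_sub_cancel_left, Nat.add_sub_cancel_left, Nat.add_sub_add_left]
      push_cast
      ring
    · intro m hm
      rw [Nat.choose_eq_zero_of_lt (Finset.mem_range.mp hm)]
      simp

theorem add_choose_right_eq_sum_range (j m : ℕ) :
    (j + m).choose m = ∑ s ∈ Finset.range (j + 1), m.choose s * j.choose s := by
  rw [← Nat.choose_symm_add, add_comm, Nat.add_choose_eq,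
    Finset.Nat.sum_antidiagonal_eq_sum_range_succ_mk]
  refine Finset.sum_congr rfl fun s hs => ?_
  rw [Nat.choose_symm (Nat.lt_succ_iff.mp (Finset.mem_range.mp hs))]

theorem sum_choose_mul_add_choose_mul_pow {R : Type*} [CommRing R] (c : R) (n j : ℕ) :
    ∑ m ∈ Finset.range (n + 1),
        ((n.choose m * (j + m).choose m : ℕ) : R) * c ^ m * (1 - c) ^ (n - m) =
      ∑ s ∈ Finset.range (j + 1), ((n.choose s * j.choose s : ℕ) : R) * c ^ s := by
  have key (s : ℕ) := sum_range_choose_mul_choose_mul_pow c (1 - c) n s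
  simp only [add_sub_cancel, one_pow, mul_one] at key
  simp only [add_choose_right_eq_sum_range, Finset.mul_sum, Nat.cast_sum, Finset.sum_mul]
  rw [Finset.sum_comm]
  refine Finset.sum_congr rfl fun s _ => ?_
  rw [Nat.cast_mul, mul_right_comm, ← key, Finset.sum_mul]
  refine Finset.sum_congr rfl fun m _ => ?_
  push_cast
  ring

/-- The two closed forms of the measurement statistics agree:
`q_{N,M}(j,c)` equals the rewriting in terms of the binomial weight
`C(M+N+1, N-j)` used in the asymptotic analysis. -/
theorem overlapDist_eq_binomial_form (N M : ℕ) (hNM : N ≤ M) (j : ℕ) (hj : j ≤ N) (c : ℝ) :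
    overlapDist N M j c =
      (((M - N + 2 * j + 1 : ℕ) : ℝ) / ((M + N + 1 : ℕ) : ℝ)) *
        (((M + N + 1).choose (N - j) : ℝ) / ((M + N).choose N : ℝ)) *
        (1 - c) ^ (N - j) *
        ∑ s ∈ Finset.range (j + 1),
          (((M - N + j).choose s * j.choose s : ℕ) : ℝ) * c ^ s := by
  obtain ⟨k, rfl⟩ := Nat.exists_eq_add_of_le hj
  obtain ⟨D, rfl⟩ := Nat.exists_eq_add_of_le hNM
  have hsum : ∑ m ∈ Finset.range (D + j + 1),
      (((D + j).choose m * (j + m).choose m : ℕ) : ℝ) * c ^ m * (1 - c) ^ (j + k + D - m) =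
      (1 - c) ^ k *
        ∑ s ∈ Finset.range (j + 1), (((D + j).choose s * j.choose s : ℕ) : ℝ) * c ^ s := by
    rw [← sum_choose_mul_add_choose_mul_pow, Finset.mul_sum]
    refine Finset.sum_congr rfl fun m hm => ?_
    have hm' := Finset.mem_range.mp hm
    rw [show j + k + D - m = k + (D + j - m) by omega, pow_add]
    ring
  rw [overlapDist, Nat.add_sub_cancel_left, Nat.add_sub_cancel_left, hsum, ← mul_assoc]
  congr 2
  rw [Nat.cast_choose ℝ (show k ≤ j + k + D + (j + k) + 1 by omega),
    Nat.cast_choose ℝ (show j + k ≤ j + k + D + (j + k) by omega),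
    show j + k + D + (j + k) + 1 - k = j + k + D + j + 1 by omega, Nat.add_sub_cancel,
    Nat.factorial_succ (j + k + D + (j + k))]
  simp only [Nat.cast_mul]
  field_simp
end

section
/- Fix integers D ≥ 0 and j₀ ≥ 0 and a real number c ∈ (0,1). Then there exist constants C > 0 and λ > 0 such that for all integers N ≥ j₀, setting M = N + D, the total probability assigned by q_{N,M}(·,c) to outcomes j ≤ j₀ is exponentially small: Σ_{j=0}^{j₀} q_{N,M}(j,c) ≤ C·e^{−λ·N}. -/
open Finset Real

theorem factorial_mul_factorial_le_of_le {N M j : ℕ} (hj : j ≤ N) (hNM : N ≤ M) :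
    N.factorial * M.factorial ≤ (N - j).factorial * (M + j + 1).factorial := by
  calc N.factorial * M.factorial
      = (N - j).factorial * N.descFactorial j * M.factorial := by
        rw [Nat.factorial_mul_descFactorial hj]
    _ ≤ (N - j).factorial * (M + 1) ^ (j + 1) * M.factorial := by
        gcongr
        calc N.descFactorial j ≤ N ^ j := Nat.descFactorial_le_pow N j
          _ ≤ (M + 1) ^ j := by gcongr; omega
          _ ≤ (M + 1) ^ (j + 1) := Nat.pow_le_pow_right (by omega) (by omega)
    _ = (N - j).factorial * (M.factorial * (M + 1) ^ (j + 1)) := by ring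
    _ ≤ (N - j).factorial * (M + j + 1).factorial := by
        gcongr
        exact Nat.factorial_mul_pow_le_factorial

/-- For a fixed difference `D` and outcome `j`, an upper bound for the ratio of
`overlapDist N (N + D) j c` to `(1 - c) ^ N`. -/
noncomputable def overlapDistConst (D j : ℕ) (c : ℝ) : ℝ :=
  ((D + 2 * j + 1 : ℕ) : ℝ) * (∑ m ∈ Finset.range (D + j + 1),
    ((Nat.choose (D + j) m * Nat.choose (j + m) m : ℕ) : ℝ) * c ^ m) / (1 - c) ^ j

theorem overlapDistConst_nonneg (D j : ℕ) {c : ℝ} (hc : c ∈ Set.Ioo (0 : ℝ) 1) :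
    0 ≤ overlapDistConst D j c := by
  have h0 : 0 ≤ c := hc.1.le
  have h1 : 0 < 1 - c := sub_pos.2 hc.2
  unfold overlapDistConst
  positivity

theorem overlapDist_le_const_mul_pow {N D j : ℕ} (hj : j ≤ N) {c : ℝ}
    (hc : c ∈ Set.Ioo (0 : ℝ) 1) :
    overlapDist N (N + D) j c ≤ overlapDistConst D j c * (1 - c) ^ N := by
  have h0 : 0 ≤ c := hc.1.le
  have h1 : 0 < 1 - c := sub_pos.2 hc.2
  have h1' : 1 - c ≤ 1 := by linarith
  have hpre : (((D + 2 * j + 1) * N.factorial * (N + D).factorial : ℕ) : ℝ) /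
      (((N - j).factorial * (N + D + j + 1).factorial : ℕ) : ℝ) ≤ ((D + 2 * j + 1 : ℕ) : ℝ) := by
    rw [div_le_iff₀ (by positivity), ← Nat.cast_mul, Nat.cast_le, mul_assoc]
    exact Nat.mul_le_mul_left _ (factorial_mul_factorial_le_of_le hj (Nat.le_add_right N D))
  have hsum : ∑ m ∈ Finset.range (D + j + 1),
      ((Nat.choose (D + j) m * Nat.choose (j + m) m : ℕ) : ℝ) * c ^ m * (1 - c) ^ (N + D - m) ≤
      (∑ m ∈ Finset.range (D + j + 1),
        ((Nat.choose (D + j) m * Nat.choose (j + m) m : ℕ) : ℝ) * c ^ m) * (1 - c) ^ (N - j) := by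
    rw [Finset.sum_mul]
    refine Finset.sum_le_sum fun m hm => ?_
    have hm' := Finset.mem_range.1 hm
    exact mul_le_mul_of_nonneg_left (pow_le_pow_of_le_one h1.le h1' (by omega)) (by positivity)
  unfold overlapDist
  rw [Nat.add_sub_cancel_left]
  refine (mul_le_mul hpre hsum (by positivity) (by positivity)).trans_eq ?_
  rw [overlapDistConst, pow_sub₀ _ h1.ne' hj]
  ring

/-- Fix `D ≥ 0`, `j₀ ≥ 0` and `c ∈ (0,1)`. Then there are constants `C > 0`, `λ > 0`
so that for all `N ≥ j₀`, with `M = N + D`, the total probability of outcomes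
`j ≤ j₀` under `q_{N,M}(·,c)` is at most `C·exp(−λN)`. -/
theorem overlapDist_small_outcomes_exponentially_small (D j₀ : ℕ) (c : ℝ)
    (hc : c ∈ Set.Ioo (0 : ℝ) 1) :
    ∃ C > (0 : ℝ), ∃ l > (0 : ℝ), ∀ N : ℕ, j₀ ≤ N →
      ∑ j ∈ Finset.range (j₀ + 1), overlapDist N (N + D) j c ≤ C * Real.exp (-l * N) := by
  have h1 : 0 < 1 - c := sub_pos.2 hc.2
  have hK : 0 ≤ ∑ j ∈ Finset.range (j₀ + 1), overlapDistConst D j c :=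
    Finset.sum_nonneg fun j _ => overlapDistConst_nonneg D j hc
  refine ⟨∑ j ∈ Finset.range (j₀ + 1), overlapDistConst D j c + 1, by linarith,
    -Real.log (1 - c), neg_pos.2 (Real.log_neg h1 (by linarith [hc.1])), fun N hN => ?_⟩
  rw [neg_neg, mul_comm (Real.log _), Real.exp_nat_mul, Real.exp_log h1]
  calc ∑ j ∈ Finset.range (j₀ + 1), overlapDist N (N + D) j c
      ≤ ∑ j ∈ Finset.range (j₀ + 1), overlapDistConst D j c * (1 - c) ^ N :=
        Finset.sum_le_sum fun j hj => overlapDist_le_const_mul_pow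
          ((Nat.lt_succ_iff.1 (Finset.mem_range.1 hj)).trans hN) hc
    _ = (∑ j ∈ Finset.range (j₀ + 1), overlapDistConst D j c) * (1 - c) ^ N :=
        (Finset.sum_mul ..).symm
    _ ≤ (∑ j ∈ Finset.range (j₀ + 1), overlapDistConst D j c + 1) * (1 - c) ^ N := by
        gcongr
        linarith
end

section
/- Fix an integer D ≥ 0 and a real number c ∈ (0,1). Then the estimator ĉ(j) = ((D+2j)/(M+N))² is asymptotically unbiased under q: with M = N + D, lim_{N→∞} Σ_{j=0}^{N} q_{N,M}(j,c)·((D+2j)/(2N+D))² = c. -/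
open Finset Filter

/-- The `c`-independent prefactor of `overlapDist N (N + D) j c`, extended by zero to `j > N`. -/
noncomputable def overlapWeight (D N j : ℕ) : ℝ :=
  (D + 2 * j + 1) * N.descFactorial j * (N + D).factorial / (N + D + j + 1).factorial

lemma cast_descFactorial_succ (n k : ℕ) :
    (n.descFactorial (k + 1) : ℝ) = (n - k) * n.descFactorial k := by
  rw [Nat.descFactorial_succ]
  rcases le_or_gt k n with h | h
  · push_cast [h]; ring
  · simp [Nat.descFactorial_of_lt h]

lemma overlapDist_eq (D N j : ℕ) (c : ℝ) (hj : j ≤ N) :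
    overlapDist N (N + D) j c = overlapWeight D N j *
      ∑ m ∈ range (D + j + 1), (((D + j).choose m * (j + m).choose m : ℕ) : ℝ) * c ^ m *
        (1 - c) ^ (N + D - m) := by
  have h : ((N - j).factorial : ℝ) * N.descFactorial j = N.factorial := by
    exact_mod_cast Nat.factorial_mul_descFactorial hj
  have h0 : ((N - j).factorial : ℝ) ≠ 0 := by positivity
  rw [overlapDist, overlapWeight, Nat.add_sub_cancel_left]
  congr 1
  push_cast
  rw [← h]
  field_simp

lemma sum_overlapWeight (D N : ℕ) : ∑ j ∈ range (N + 1), overlapWeight D N j = 1 := by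
  have h : ∀ j, overlapWeight D N j =
      (N.descFactorial j * (N + D).factorial / (N + D + j).factorial : ℝ) -
        N.descFactorial (j + 1) * (N + D).factorial / (N + D + (j + 1)).factorial := by
    intro j
    rw [overlapWeight, cast_descFactorial_succ, ← add_assoc, Nat.factorial_succ (N + D + j)]
    push_cast
    field_simp
    ring
  simp_rw [h]
  rw [sum_range_sub']
  have : ((N + D).factorial : ℝ) ≠ 0 := by positivity
  simp [this]

lemma overlapWeight_succ_mul (D N j : ℕ) :
    overlapWeight D (N + 1) j * ((N + 1 - j) * (N + 1 + D + j + 1)) =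
      (N + 1) * (N + 1 + D) * overlapWeight D N j := by
  have h : (N + 1 - j : ℝ) * (N + 1).descFactorial j = (N + 1) * N.descFactorial j := by
    have h1 := cast_descFactorial_succ (N + 1) j
    rw [Nat.succ_descFactorial_succ] at h1
    push_cast at h1
    exact h1.symm
  have e1 : (N + 1 + D).factorial = (N + D + 1) * (N + D).factorial := by
    rw [← Nat.factorial_succ]; congr 1; ring
  have e2 : (N + 1 + D + j + 1).factorial = (N + D + j + 2) * (N + D + j + 1).factorial := by
    rw [← Nat.factorial_succ]; congr 1; ring
  rw [overlapWeight, overlapWeight, e1, e2]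
  push_cast
  rw [div_mul_eq_mul_div, mul_div_assoc', div_eq_div_iff (by positivity) (by positivity)]
  linear_combination (D + 2 * j + 1 : ℝ) * (N + D + 1) * (N + D).factorial * (N + D + j + 2) *
    (N + D + j + 1).factorial * h

lemma cast_choose_succ_mul (n k : ℕ) :
    (n.choose (k + 1) : ℝ) * (k + 1) = n.choose k * (n - k) := by
  rcases le_or_gt k n with h | h
  · have := Nat.choose_succ_right_eq n k
    rw [← Nat.cast_sub h]
    exact_mod_cast this
  · simp [Nat.choose_eq_zero_of_lt h, Nat.choose_eq_zero_of_lt (h.trans (Nat.lt_succ_self k))]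

lemma cast_choose_mul_choose_succ (D j m : ℕ) :
    ((m : ℝ) + 1) ^ 2 * ((D + j).choose (m + 1) * (j + (m + 1)).choose (m + 1)) =
      (D + j - m) * (j + 1 + m) * ((D + j).choose m * (j + m).choose m) := by
  have h1 := cast_choose_succ_mul (D + j) m
  have h2 : ((j + m + 1 : ℕ) : ℝ) * (j + m).choose m =
      (j + (m + 1)).choose (m + 1) * (m + 1 : ℕ) := by
    exact_mod_cast Nat.add_one_mul_choose_eq (j + m) m
  push_cast at h1 h2
  linear_combination (m + 1 : ℝ) * (j + (m + 1)).choose (m + 1) * h1 -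
    ((D + j).choose m : ℝ) * (D + j - m) * h2

lemma sum_overlapWeight_mul_choose (D m N : ℕ) :
    ∑ j ∈ range (N + 1), overlapWeight D N j * ((D + j).choose m * (j + m).choose m) =
      ((N + D).choose m : ℝ) := by
  induction m generalizing N with
  | zero => simpa using sum_overlapWeight D N
  | succ m ih =>
    have hm : ((m : ℝ) + 1) ^ 2 ≠ 0 := by positivity
    have hN := cast_choose_succ_mul (N + D) m
    push_cast at hN
    have key : ∑ j ∈ range (N + 1), overlapWeight D N j * ((N - j) * (N + D + j + 1)) *
        ((D + j).choose m * (j + m).choose m) = N * ((N + D - m) * ((N + D).choose m : ℝ)) := by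
      cases N with
      | zero => simp
      | succ N =>
        have h1 := Nat.add_one_mul_choose_eq (N + D) m
        have h2 := cast_choose_succ_mul (N + 1 + D) m
        rw [show N + D + 1 = N + 1 + D by ring] at h1
        have h1' : ((N + 1 + D : ℕ) : ℝ) * (N + D).choose m =
            (N + 1 + D).choose (m + 1) * (m + 1 : ℕ) := by exact_mod_cast h1
        push_cast at h1' h2 ⊢
        simp_rw [overlapWeight_succ_mul]
        rw [sum_range_succ]
        simp_rw [mul_assoc _ (overlapWeight D N _)]
        rw [← mul_sum, ih]
        have h0 : overlapWeight D N (N + 1) = 0 := by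
          simp [overlapWeight]
        rw [h0]
        linear_combination (N + 1 : ℝ) * (h1' + h2)
    apply mul_left_cancel₀ hm
    calc _ = ∑ j ∈ range (N + 1), ((N + D - m) * (N + 1 + m) *
            (overlapWeight D N j * ((D + j).choose m * (j + m).choose m)) -
            overlapWeight D N j * ((N - j) * (N + D + j + 1)) *
              ((D + j).choose m * (j + m).choose m)) := by
          rw [mul_sum]
          refine sum_congr rfl fun j _ => ?_
          linear_combination overlapWeight D N j * cast_choose_mul_choose_succ D j m
      _ = _ := by
          rw [sum_sub_distrib, ← mul_sum, ih, key]
          linear_combination (-(m + 1) : ℝ) * hN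

lemma sum_overlapDist (D N : ℕ) (c : ℝ) :
    ∑ j ∈ range (N + 1), overlapDist N (N + D) j c = 1 := by
  have h : ∀ j ∈ range (N + 1), overlapDist N (N + D) j c = ∑ m ∈ range (N + D + 1),
      overlapWeight D N j * ((D + j).choose m * (j + m).choose m) *
        (c ^ m * (1 - c) ^ (N + D - m)) := by
    intro j hj
    have hj : j ≤ N := Nat.lt_succ_iff.mp (mem_range.mp hj)
    rw [overlapDist_eq D N j c hj, mul_sum]
    push_cast
    rw [← sum_subset (range_mono (by omega : D + j + 1 ≤ N + D + 1))]
    · refine sum_congr rfl fun m _ => by ring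
    · intro m _ hm
      rw [mem_range, not_lt] at hm
      rw [Nat.choose_eq_zero_of_lt (by omega : D + j < m)]
      simp
  rw [sum_congr rfl h, sum_comm]
  simp_rw [← sum_mul, sum_overlapWeight_mul_choose]
  have := add_pow c (1 - c) (N + D)
  rw [add_sub_cancel, one_pow] at this
  refine Eq.trans ?_ this.symm
  exact sum_congr rfl fun m _ => by ring

lemma overlapDist_nonneg (N M j : ℕ) {c : ℝ} (h0 : 0 ≤ c) (h1 : c ≤ 1) :
    0 ≤ overlapDist N M j c := by
  have : 0 ≤ 1 - c := sub_nonneg.mpr h1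
  unfold overlapDist
  positivity

lemma overlapDist_succ_mul (D N j : ℕ) (c : ℝ) (hj : j ≤ N) :
    overlapDist (N + 1) (N + 1 + D) j c * ((N + 1 - j) * (N + 1 + D + j + 1)) =
      (N + 1) * (N + 1 + D) * (1 - c) * overlapDist N (N + D) j c := by
  have h : ∑ m ∈ range (D + j + 1), (((D + j).choose m * (j + m).choose m : ℕ) : ℝ) * c ^ m *
        (1 - c) ^ (N + 1 + D - m) = (1 - c) * ∑ m ∈ range (D + j + 1),
        (((D + j).choose m * (j + m).choose m : ℕ) : ℝ) * c ^ m * (1 - c) ^ (N + D - m) := by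
    rw [mul_sum]
    refine sum_congr rfl fun m hm => ?_
    rw [mem_range] at hm
    rw [show N + 1 + D - m = N + D - m + 1 by omega, pow_succ]
    ring
  rw [overlapDist_eq D N j c hj, overlapDist_eq D (N + 1) j c (by omega), h]
  linear_combination ((1 - c) * ∑ m ∈ range (D + j + 1),
    (((D + j).choose m * (j + m).choose m : ℕ) : ℝ) * c ^ m * (1 - c) ^ (N + D - m)) *
      overlapWeight_succ_mul D N j

lemma sum_overlapDist_mul_sub_mul (D N : ℕ) (c : ℝ) :
    ∑ j ∈ range (N + 1), overlapDist N (N + D) j c * ((N - j) * (N + D + j + 1)) =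
      N * (N + D) * (1 - c) := by
  cases N with
  | zero => simp
  | succ N =>
    push_cast
    rw [sum_range_succ, sum_congr rfl fun j hj =>
      overlapDist_succ_mul D N j c (Nat.lt_succ_iff.mp (mem_range.mp hj)), ← mul_sum,
      sum_overlapDist]
    push_cast
    ring

/-- The second moment of `D + 2j`, in terms of the first moment of `j`. -/
lemma sum_overlapDist_mul_sq (D N : ℕ) (c : ℝ) :
    ∑ j ∈ range (N + 1), overlapDist N (N + D) j c * ((D : ℝ) + 2 * j) ^ 2 =
      D ^ 2 + 4 * (N * (N + D) * c + N) -
        4 * ∑ j ∈ range (N + 1), overlapDist N (N + D) j c * j := by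
  calc _ = ∑ j ∈ range (N + 1), ((D ^ 2 + 4 * (N * (N + D + 1) : ℝ)) * overlapDist N (N + D) j c -
        4 * (overlapDist N (N + D) j c * ((N - j) * (N + D + j + 1))) -
        4 * (overlapDist N (N + D) j c * j)) := sum_congr rfl fun j _ => by ring
    _ = _ := by
      rw [sum_sub_distrib, sum_sub_distrib, ← mul_sum, ← mul_sum, ← mul_sum, sum_overlapDist,
        sum_overlapDist_mul_sub_mul]
      ring

/-- Fix `D ≥ 0` and `c ∈ (0,1)`. The estimator `ĉ(j) = ((D+2j)/(M+N))²` is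
asymptotically unbiased under `q`: with `M = N + D`,
`lim_{N→∞} Σ_{j=0}^N q_{N,M}(j,c)·((D+2j)/(2N+D))² = c`. -/
theorem overlapEstimator_asymptotically_unbiased (D : ℕ) (c : ℝ)
    (hc : c ∈ Set.Ioo (0 : ℝ) 1) :
    Tendsto (fun N : ℕ =>
        ∑ j ∈ Finset.range (N + 1),
          overlapDist N (N + D) j c * (((D : ℝ) + 2 * j) / (2 * N + D)) ^ 2)
      atTop (nhds c) := by
  obtain ⟨h0, h1⟩ := hc
  have hinv : Tendsto (fun N : ℕ => (1 : ℝ) / (2 * N + D)) atTop (nhds 0) := by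
    refine tendsto_const_nhds.div_atTop (tendsto_atTop_add_const_right _ _ ?_)
    exact tendsto_natCast_atTop_atTop.const_mul_atTop two_pos
  have hpos : ∀ᶠ N : ℕ in atTop, (0 : ℝ) < 2 * N + D := by
    filter_upwards [eventually_gt_atTop 0] with N hN
    positivity
  have hlow : Tendsto (fun N : ℕ => (D ^ 2 + 4 * (N * (N + D) * c)) / (2 * N + D : ℝ) ^ 2)
      atTop (nhds c) := by
    have h := ((hinv.pow 2).const_mul ((D : ℝ) ^ 2 * (1 - c))).const_add c
    rw [zero_pow two_ne_zero, mul_zero, add_zero] at h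
    refine h.congr' ?_
    filter_upwards [hpos] with N hN
    field_simp
    ring
  have hup : Tendsto (fun N : ℕ => (D ^ 2 + 4 * (N * (N + D) * c)) / (2 * N + D : ℝ) ^ 2 +
      2 * (1 / (2 * N + D))) atTop (nhds c) := by
    simpa using hlow.add (hinv.const_mul 2)
  have heq : ∀ N : ℕ, ∑ j ∈ range (N + 1),
      overlapDist N (N + D) j c * (((D : ℝ) + 2 * j) / (2 * N + D)) ^ 2 =
      (D ^ 2 + 4 * (N * (N + D) * c + N) -
        4 * ∑ j ∈ range (N + 1), overlapDist N (N + D) j c * j) / (2 * N + D) ^ 2 := by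
    intro N
    rw [← sum_overlapDist_mul_sq, sum_div]
    exact sum_congr rfl fun j _ => by rw [div_pow, mul_div_assoc]
  simp_rw [heq]
  refine tendsto_of_tendsto_of_tendsto_of_le_of_le' hlow hup ?_ ?_
  · refine Eventually.of_forall fun N => ?_
    have hmean : ∑ j ∈ range (N + 1), overlapDist N (N + D) j c * j ≤ N := by
      calc _ ≤ ∑ j ∈ range (N + 1), overlapDist N (N + D) j c * N := by
            refine sum_le_sum fun j hj => mul_le_mul_of_nonneg_left ?_
              (overlapDist_nonneg N (N + D) j h0.le h1.le)
            exact_mod_cast Nat.lt_succ_iff.mp (mem_range.mp hj)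
        _ = N := by rw [← sum_mul, sum_overlapDist, one_mul]
    gcongr
    linarith
  · filter_upwards [hpos] with N hN
    have hmean : 0 ≤ ∑ j ∈ range (N + 1), overlapDist N (N + D) j c * j :=
      sum_nonneg fun j _ => mul_nonneg (overlapDist_nonneg N (N + D) j h0.le h1.le) j.cast_nonneg
    rw [show (2 : ℝ) * (1 / (2 * N + D)) = 2 * (2 * N + D) / (2 * N + D) ^ 2 by field_simp,
      ← add_div]
    gcongr
    have : (0 : ℝ) ≤ D := D.cast_nonneg
    linarith
end

section
/- Let d ≥ 2, M ≥ N ≥ 0 be integers with D = M − N, and let j ∈ {0,1,…,N}. Then the posterior mean of the overlap given measurement outcome j, with respect to the prior density p_d(c) = (d−1)(1−c)^{d−2} on [0,1], has the closed form: (∫_0^1 c·(1−c)^{d−2}·q_{N,M}(j,c) dc) / (∫_0^1 (1−c)^{d−2}·q_{N,M}(j,c) dc) = [4d + (D+2j)(D+2j+2) + 2(M+N) − (M+N)² + 4MN] / (4(d+M)(d+N)). -/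
open Finset intervalIntegral

open Nat in
/-- Euler's beta integral at natural exponents. -/
theorem integral_pow_mul_one_sub_pow (a b : ℕ) :
    ∫ x in (0:ℝ)..1, x ^ a * (1 - x) ^ b = (a ! * b ! : ℝ) / (a + b + 1)! := by
  have h := Complex.Gamma_mul_Gamma_eq_betaIntegral (s := a + 1) (t := b + 1)
    (by simp; positivity) (by simp; positivity)
  have hint : Complex.betaIntegral (a + 1) (b + 1) =
      ((∫ x in (0:ℝ)..1, x ^ a * (1 - x) ^ b : ℝ) : ℂ) := by
    rw [Complex.betaIntegral, ← intervalIntegral.integral_ofReal]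
    simp
  have hab : (a + 1 + (b + 1) : ℂ) = ((a + b + 1 : ℕ) : ℂ) + 1 := by push_cast; ring
  rw [hint, hab, Complex.Gamma_nat_eq_factorial, Complex.Gamma_nat_eq_factorial,
    Complex.Gamma_nat_eq_factorial] at h
  rw [eq_div_iff (by positivity), mul_comm]
  exact_mod_cast h.symm

open Nat in
/-- A form of the Chu–Vandermonde identity, with rising factorials written as quotients of
factorials. -/
theorem sum_antidiagonal_choose_mul_factorial_mul_factorial (n j b : ℕ) :
    ∑ p ∈ antidiagonal n, (n.choose p.1 : ℝ) * (((j + p.1)! : ℝ) * (b + p.2)!) =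
      (j ! * b ! * (j + b + n + 1)! : ℝ) / (j + b + 1)! := by
  induction n generalizing j b with
  | zero =>
    simp
    field_simp
  | succ n ih =>
    rw [sum_antidiagonal_choose_succ_mul (fun i k => ((j + i)! : ℝ) * (b + k)!)]
    have h₁ := ih j (b + 1)
    have h₂ := ih (j + 1) b
    have h₃ : ∑ p ∈ antidiagonal n, (n.choose p.2 : ℝ) * (((j + (p.1 + 1))! : ℝ) * (b + p.2)!) =
        ∑ p ∈ antidiagonal n, (n.choose p.1 : ℝ) * (((j + 1 + p.1)! : ℝ) * (b + p.2)!) := by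
      refine sum_congr rfl fun p hp => ?_
      rw [choose_symm_of_eq_add (mem_antidiagonal.1 hp).symm, add_right_comm j 1, add_assoc j]
    have h₄ : ∑ p ∈ antidiagonal n, (n.choose p.1 : ℝ) * (((j + p.1)! : ℝ) * (b + (p.2 + 1))!) =
        ∑ p ∈ antidiagonal n, (n.choose p.1 : ℝ) * (((j + p.1)! : ℝ) * (b + 1 + p.2)!) := by
      refine sum_congr rfl fun p _ => ?_
      rw [add_right_comm b 1, add_assoc b]
    rw [h₃, h₄, h₁, h₂, show j + (b + 1) + n + 1 = j + b + (n + 1) + 1 by ring,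
      show j + 1 + b + n + 1 = j + b + (n + 1) + 1 by ring,
      show j + (b + 1) + 1 = j + b + 1 + 1 by ring, show j + 1 + b + 1 = j + b + 1 + 1 by ring,
      factorial_succ j, factorial_succ b, factorial_succ (j + b + 1)]
    push_cast
    field_simp
    ring

open Nat in
/-- Moments of `overlapDist` against `(1 - c) ^ e`, with `N = j + a` and `M = D + j + a`. -/
theorem integral_pow_mul_overlapDist (i e j a D : ℕ) :
    ∫ c in (0:ℝ)..1, c ^ i * (1 - c) ^ e * overlapDist (j + a) (D + j + a) j c =
      (((D + 2 * j + 1) * (j + a)! * (D + j + a)! : ℕ) : ℝ) /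
        ((a ! * (D + j + a + j + 1)! : ℕ) : ℝ) *
      ∑ p ∈ antidiagonal (D + j), ((D + j).choose p.1 : ℝ) *
        ((((j + p.1).choose p.1 : ℝ) * (i + p.1)!) * (a + e + p.2)! /
          (D + j + a + e + i + 1)!) := by
  have hsub : D + j + a - (j + a) = D := by omega
  have hsub' : j + a - j = a := by omega
  simp only [overlapDist, hsub, hsub']
  rw [Finset.Nat.sum_antidiagonal_eq_sum_range_succ_mk]
  set K : ℝ := (((D + 2 * j + 1) * (j + a)! * (D + j + a)! : ℕ) : ℝ) /
    ((a ! * (D + j + a + j + 1)! : ℕ) : ℝ)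
  have hint : ∀ c : ℝ, c ^ i * (1 - c) ^ e * (K * ∑ m ∈ range (D + j + 1),
      (((D + j).choose m * (j + m).choose m : ℕ) : ℝ) * c ^ m * (1 - c) ^ (D + j + a - m)) =
      K * ∑ m ∈ range (D + j + 1), (((D + j).choose m * (j + m).choose m : ℕ) : ℝ) *
        (c ^ (i + m) * (1 - c) ^ (a + e + (D + j - m))) := by
    intro c
    rw [mul_left_comm, mul_sum]
    congr 1
    refine sum_congr rfl fun m hm => ?_
    rw [show D + j + a - m = a + (D + j - m) by have := mem_range.1 hm; omega]
    ring
  simp_rw [hint]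
  rw [intervalIntegral.integral_const_mul, intervalIntegral.integral_finsetSum
    (fun m _ => Continuous.intervalIntegrable (by fun_prop) _ _)]
  congr 1
  refine sum_congr rfl fun m hm => ?_
  rw [intervalIntegral.integral_const_mul, integral_pow_mul_one_sub_pow,
    show i + m + (a + e + (D + j - m)) + 1 = D + j + a + e + i + 1 by
      have := mem_range.1 hm; omega]
  push_cast
  ring

open Nat in
/-- The posterior mean of the overlap for `N = j + a`, `M = D + j + a` and `d = e + 2`. -/
theorem posterior_mean_overlapDist_add (e j a D : ℕ) :
    (∫ c in (0:ℝ)..1, c * (1 - c) ^ e * overlapDist (j + a) (D + j + a) j c) /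
      (∫ c in (0:ℝ)..1, (1 - c) ^ e * overlapDist (j + a) (D + j + a) j c) =
    ((j + 1) * (D + 2 * j + a + e + 2) - j * (j + a + e + 2) : ℝ) /
      ((D + j + a + e + 2) * (j + a + e + 2)) := by
  have hnum := integral_pow_mul_overlapDist 1 e j a D
  have hden := integral_pow_mul_overlapDist 0 e j a D
  simp only [pow_one, pow_zero, one_mul] at hnum hden
  rw [hnum, hden, mul_div_mul_left _ _ (by positivity)]
  have hchoose : ∀ m : ℕ, ((j + m).choose m : ℝ) = ((j + m)! : ℝ) / (j ! * m !) := by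
    intro m
    rw [← choose_symm_add, cast_add_choose]
  have hS := sum_antidiagonal_choose_mul_factorial_mul_factorial (D + j) j (a + e)
  have hS' := sum_antidiagonal_choose_mul_factorial_mul_factorial (D + j) (j + 1) (a + e)
  have hB : ∑ p ∈ antidiagonal (D + j), ((D + j).choose p.1 : ℝ) *
        ((((j + p.1).choose p.1 : ℝ) * (0 + p.1)!) * (a + e + p.2)! /
          (D + j + a + e + 0 + 1)!) =
      (∑ p ∈ antidiagonal (D + j), ((D + j).choose p.1 : ℝ) *
        (((j + p.1)! : ℝ) * (a + e + p.2)!)) / (j ! * (D + j + a + e + 1)!) := by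
    rw [sum_div]
    refine sum_congr rfl fun p _ => ?_
    rw [hchoose, zero_add, add_zero]
    field_simp
  have hA : ∑ p ∈ antidiagonal (D + j), ((D + j).choose p.1 : ℝ) *
        ((((j + p.1).choose p.1 : ℝ) * (1 + p.1)!) * (a + e + p.2)! /
          (D + j + a + e + 1 + 1)!) =
      (∑ p ∈ antidiagonal (D + j), ((D + j).choose p.1 : ℝ) *
          (((j + 1 + p.1)! : ℝ) * (a + e + p.2)!) -
        j * ∑ p ∈ antidiagonal (D + j), ((D + j).choose p.1 : ℝ) *
          (((j + p.1)! : ℝ) * (a + e + p.2)!)) / (j ! * (D + j + a + e + 1 + 1)!) := by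
    rw [mul_sum, ← sum_sub_distrib, sum_div]
    refine sum_congr rfl fun p _ => ?_
    rw [hchoose, add_comm 1, add_right_comm j 1, factorial_succ p.1,
      factorial_succ (j + p.1)]
    push_cast
    field_simp
    ring
  rw [hA, hB, hS, hS', show j + 1 + (a + e) + (D + j) + 1 = j + (a + e) + (D + j) + 1 + 1 by ring,
    show j + 1 + (a + e) + 1 = j + (a + e) + 1 + 1 by ring,
    factorial_succ j, factorial_succ (j + (a + e) + (D + j) + 1),
    factorial_succ (j + (a + e) + 1), factorial_succ (D + j + a + e + 1)]
  rw [show j + (a + e) + (D + j) + 1 = D + 2 * j + a + e + 1 by ring]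
  push_cast
  field_simp
  ring

/-- For `d ≥ 2`, `M ≥ N ≥ 0`, `D = M − N` and `j ∈ {0,…,N}`, the posterior mean of the
overlap given outcome `j`, w.r.t. the prior density `p_d(c) = (d−1)(1−c)^{d−2}` on `[0,1]`,
has the closed form
`(∫₀¹ c(1−c)^{d−2} q dc)/(∫₀¹ (1−c)^{d−2} q dc)
  = (4d + (D+2j)(D+2j+2) + 2(M+N) − (M+N)² + 4MN)/(4(d+M)(d+N))`. -/
theorem posterior_mean_closed_form (d N M j : ℕ) (hd : 2 ≤ d) (hNM : N ≤ M) (hj : j ≤ N) :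
    (∫ c in (0:ℝ)..1, c * (1 - c) ^ (d - 2) * overlapDist N M j c) /
      (∫ c in (0:ℝ)..1, (1 - c) ^ (d - 2) * overlapDist N M j c) =
    (4 * (d : ℝ) + ((M : ℝ) - N + 2 * j) * ((M : ℝ) - N + 2 * j + 2)
        + 2 * ((M : ℝ) + N) - ((M : ℝ) + N) ^ 2 + 4 * M * N) /
      (4 * ((d : ℝ) + M) * ((d : ℝ) + N)) := by
  obtain ⟨e, rfl⟩ := Nat.exists_eq_add_of_le' hd
  obtain ⟨a, rfl⟩ := Nat.exists_eq_add_of_le hj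
  obtain ⟨D, rfl⟩ := Nat.exists_eq_add_of_le hNM
  rw [show j + a + D = D + j + a by ring, Nat.add_sub_cancel, posterior_mean_overlapDist_add]
  push_cast
  rw [div_eq_div_iff (by positivity) (by positivity)]
  ring
end

section
/- Let d ≥ 2 and M ≥ N ≥ 0 be integers with D = M − N. Then the SU(d) irrep dimensions given by the hook-length formula for the two-row Young diagrams occurring in the tensor product of the symmetric representations on N and M qudits sum to the product of the dimensions of those symmetric representations: Σ_{j=0}^{N} (D+2j+1)·(d+M+j−1)!·(d+N−j−2)! / ((d−1)!·(d−2)!·(M+j+1)!·(N−j)!) = C(N+d−1, d−1)·C(M+d−1, d−1), where C(a,b) denotes the binomial coefficient. -/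
open Finset

theorem cast_add_choose_right (a c : ℕ) :
    ((a + c).choose c : ℝ) = (a + c).factorial / (c.factorial * a.factorial) := by
  rw [← Nat.choose_symm_add, Nat.cast_add_choose, mul_comm]

theorem cast_choose_add_succ_eq_div (b e : ℕ) :
    ((b + e).choose (e + 1) : ℝ) =
      (b * (b + e).factorial : ℝ) / ((e + 1).factorial * b.factorial) := by
  cases b with
  | zero => simp
  | succ k =>
    have h : k + 1 + e = k + (e + 1) := by omega
    rw [h, cast_add_choose_right, Nat.factorial_succ k]
    have hk : (k.factorial : ℝ) ≠ 0 := by positivity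
    have he : ((e + 1).factorial : ℝ) ≠ 0 := by positivity
    push_cast
    field_simp

/-- The dimension of the two-row representation as a two-by-two determinant of dimensions of
symmetric representations. -/
theorem two_row_dimension_eq_sub (a b e : ℕ) :
    (((a : ℝ) - b + 1) * (a + e + 1).factorial * (b + e).factorial) /
        ((e + 1).factorial * e.factorial * (a + 1).factorial * b.factorial) =
      ((a + e + 1).choose (e + 1) : ℝ) * (b + e + 1).choose (e + 1) -
        ((a + e + 2).choose (e + 1) : ℝ) * (b + e).choose (e + 1) := by
  have h : a + e + 2 = (a + 1) + (e + 1) := by omega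
  rw [cast_choose_add_succ_eq_div, h, cast_add_choose_right, Nat.add_assoc a e 1,
    Nat.add_assoc b e 1, cast_add_choose_right, cast_add_choose_right]
  have h1 : (a + 1 + (e + 1)).factorial = (a + e + 2) * (a + (e + 1)).factorial := by
    rw [← h]; exact Nat.factorial_succ _
  have h2 : (b + (e + 1)).factorial = (b + e + 1) * (b + e).factorial := Nat.factorial_succ _
  rw [h1, h2, Nat.factorial_succ a, Nat.factorial_succ e]
  have ha : (a.factorial : ℝ) ≠ 0 := by positivity
  have hb : (b.factorial : ℝ) ≠ 0 := by positivity
  have he : (e.factorial : ℝ) ≠ 0 := by positivity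
  push_cast
  field_simp
  ring

/-- For `d ≥ 2` and `M ≥ N ≥ 0` with `D = M − N`, the SU(d) irrep dimensions given by the
hook-length formula for the two-row Young diagrams occurring in
`Sym^N(ℂ^d) ⊗ Sym^M(ℂ^d) ≅ ⊕_{j=0}^N U^{(J)}`, `J = D/2 + j`, sum to the product of the
dimensions of the two symmetric representations:
`Σ_{j=0}^N (D+2j+1)(d+M+j−1)!(d+N−j−2)!/((d−1)!(d−2)!(M+j+1)!(N−j)!)
  = C(N+d−1,d−1)·C(M+d−1,d−1)`. -/
theorem hook_dimension_sum (d N M : ℕ) (hd : 2 ≤ d) (hNM : N ≤ M) :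
    ∑ j ∈ Finset.range (N + 1),
      (((M - N + 2 * j + 1) : ℕ) * Nat.factorial (d + M + j - 1) *
          Nat.factorial (d + N - j - 2) : ℝ) /
        ((Nat.factorial (d - 1) : ℝ) * Nat.factorial (d - 2) *
          Nat.factorial (M + j + 1) * Nat.factorial (N - j)) =
      ((N + d - 1).choose (d - 1) : ℝ) * ((M + d - 1).choose (d - 1) : ℝ) := by
  obtain ⟨e, rfl⟩ := Nat.exists_eq_add_of_le' hd
  let G : ℕ → ℝ := fun j =>
    ((M + j + e + 1).choose (e + 1) : ℝ) * ((N + e + 1 - j).choose (e + 1) : ℝ)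
  have hG : G (N + 1) = 0 := by
    have h : N + e + 1 - (N + 1) = e := by omega
    simp [G, h]
  trans ∑ j ∈ Finset.range (N + 1), (G j - G (j + 1))
  · refine Finset.sum_congr rfl fun j hj => ?_
    obtain ⟨k, rfl⟩ := Nat.exists_eq_add_of_le (Finset.mem_range_succ_iff.mp hj)
    have hc : ((M - (j + k) + 2 * j + 1 : ℕ) : ℝ) = ((M + j : ℕ) : ℝ) - k + 1 := by
      push_cast [Nat.cast_sub hNM]
      ring
    have h1 : e + 2 + M + j - 1 = M + j + e + 1 := by omega
    have h2 : e + 2 + (j + k) - j - 2 = k + e := by omega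
    have h3 : j + k - j = k := by omega
    have h4 : j + k + e + 1 - j = k + e + 1 := by omega
    have h5 : j + k + e + 1 - (j + 1) = k + e := by omega
    have h6 : M + (j + 1) + e + 1 = M + j + e + 2 := by omega
    simp only [G, hc, h1, h2, h3, h4, h5, h6, Nat.add_sub_cancel,
      show e + 2 - 1 = e + 1 from rfl]
    exact two_row_dimension_eq_sub (M + j) k e
  · rw [Finset.sum_range_sub', hG, sub_zero, mul_comm]
    rfl
end

section
/- Let d ≥ 2 and M, N ≥ 0 be integers. Then the global mean square error of the estimate-and-estimate strategy satisfies the exact integral identity: ∫_0^1 (d−1)(1−c)^{d−2}·c² dc − ∫_0^1 (d−1)(1−w)^{d−2}·[(d+M+N+MNw)/((d+M)(d+N))]² dw = (d−1)(d+M+N)(d² + 2MN + d(M+N)) / (d(d+1)(d+M)²(d+N)²). -/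
open intervalIntegral

/-- The second moment of an affine function against the density `(n + 1) (1 - x) ^ n`. -/
theorem integral_one_sub_pow_mul_affine_sq (n : ℕ) (a b : ℝ) :
    ∫ x in (0:ℝ)..1, ((n : ℝ) + 1) * (1 - x) ^ n * (a + b * x) ^ 2 =
      a ^ 2 + 2 * a * b / (n + 2) + 2 * b ^ 2 / ((n + 2) * (n + 3)) := by
  have reflect := integral_comp_sub_left (a := (0:ℝ)) (b := 1)
    (fun y : ℝ => ((n : ℝ) + 1) * y ^ n * (a + b * (1 - y)) ^ 2) 1
  simp only [sub_sub_cancel, sub_self, sub_zero] at reflect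
  have expand (y : ℝ) : ((n : ℝ) + 1) * y ^ n * (a + b * (1 - y)) ^ 2 =
      (n + 1) * (a + b) ^ 2 * y ^ n - (n + 1) * (2 * (a + b) * b) * y ^ (n + 1) +
        (n + 1) * b ^ 2 * y ^ (n + 2) := by ring
  have integrable (c : ℝ) (k : ℕ) :
      IntervalIntegrable (fun y : ℝ => c * y ^ k) MeasureTheory.volume 0 1 :=
    Continuous.intervalIntegrable (by fun_prop) 0 1
  rw [reflect, integral_congr fun y _ => expand y,
    integral_add ((integrable _ _).sub (integrable _ _)) (integrable _ _),
    integral_sub (integrable _ _) (integrable _ _)]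
  simp only [integral_const_mul, integral_pow]
  push_cast
  have h₁ : (n : ℝ) + 1 ≠ 0 := by positivity
  have h₂ : (n : ℝ) + 2 ≠ 0 := by positivity
  have h₃ : (n : ℝ) + 3 ≠ 0 := by positivity
  rw [show (n : ℝ) + 1 + 1 = n + 2 by ring, show (n : ℝ) + 2 + 1 = n + 3 by ring]
  simp only [one_pow, zero_pow (Nat.succ_ne_zero _), sub_zero]
  field_simp
  ring

/-- For `d ≥ 2` and `M, N ≥ 0`, the global mean square error of the
estimate-and-estimate strategy satisfies the exact integral identity:
the prior second moment of `c` minus the mean of the squared Bayesian estimator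
`c(w) = (d+M+N+MNw)/((d+M)(d+N))` over the density `(d−1)(1−w)^{d−2}` equals
`(d−1)(d+M+N)(d²+2MN+d(M+N))/(d(d+1)(d+M)²(d+N)²)`. -/
theorem estimate_and_estimate_mse (d M N : ℕ) (hd : 2 ≤ d) :
    (∫ c in (0:ℝ)..1, ((d : ℝ) - 1) * (1 - c) ^ (d - 2) * c ^ 2) -
      (∫ w in (0:ℝ)..1, ((d : ℝ) - 1) * (1 - w) ^ (d - 2) *
        (((d : ℝ) + M + N + M * N * w) / (((d : ℝ) + M) * ((d : ℝ) + N))) ^ 2) =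
    ((d : ℝ) - 1) * ((d : ℝ) + M + N) * ((d : ℝ) ^ 2 + 2 * M * N + (d : ℝ) * (M + N)) /
      ((d : ℝ) * ((d : ℝ) + 1) * ((d : ℝ) + M) ^ 2 * ((d : ℝ) + N) ^ 2) := by
  obtain ⟨n, rfl⟩ := Nat.exists_eq_add_of_le' hd
  have estimator (w : ℝ) :
      (((n + 2 : ℕ) : ℝ) + M + N + M * N * w) /
          ((((n + 2 : ℕ) : ℝ) + M) * (((n + 2 : ℕ) : ℝ) + N)) =
        (((n + 2 : ℕ) : ℝ) + M + N) / ((((n + 2 : ℕ) : ℝ) + M) * (((n + 2 : ℕ) : ℝ) + N)) +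
          M * N / ((((n + 2 : ℕ) : ℝ) + M) * (((n + 2 : ℕ) : ℝ) + N)) * w := by ring
  have prior := integral_one_sub_pow_mul_affine_sq n 0 1
  simp only [zero_add, one_mul] at prior
  have hn : ((n + 2 : ℕ) : ℝ) - 1 = n + 1 := by push_cast; ring
  simp only [estimator, hn, Nat.add_sub_cancel]
  rw [prior, integral_one_sub_pow_mul_affine_sq]
  push_cast
  rw [show (n : ℝ) + 2 + 1 = n + 3 by ring]
  have hM : (n : ℝ) + 2 + M ≠ 0 := by positivity
  have hN : (n : ℝ) + 2 + N ≠ 0 := by positivity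
  field_simp
  ring
end
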